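/- arXiv:1407.7828 — 2 statements merged into one kernel-verified Lean document; each statement's English description precedes it below -/
import Mathlib

section
/- Let F : ℝ³ → ℝ³ be a C¹ vector field such that F is Lebesgue integrable on ℝ³ and the function x ↦ ‖DF(x)‖ (the operator norm of the Fréchet derivative of F at x) is Lebesgue integrable on ℝ³. Then ∫_{ℝ³} div F(x) dx = 0. -/
open MeasureTheory

/-- Euclidean three-space. -/
abbrev E3 := EuclideanSpace ℝ (Fin 3)

/-- Divergence of a vector field on `ℝ³`: the trace of its Fréchet derivative,
`div F x = ∑ i ∂ᵢ Fᵢ(x)`. -/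
noncomputable def div3 (F : E3 → E3) (x : E3) : ℝ :=
  ∑ i, fderiv ℝ F x (EuclideanSpace.single i 1) i

/-- The integral over the whole space of a directional derivative vanishes, if the function and
that derivative are integrable. -/
theorem integral_fderiv_apply_eq_zero {E G : Type*}
    [NormedAddCommGroup E] [NormedSpace ℝ E] [FiniteDimensional ℝ E]
    [MeasurableSpace E] [BorelSpace E] {μ : Measure E} [μ.IsAddHaarMeasure]
    [NormedAddCommGroup G] [NormedSpace ℝ G] {g : E → G} {v : E}
    (hg : Differentiable ℝ g) (hgint : Integrable g μ)
    (hg'int : Integrable (fun x => fderiv ℝ g x v) μ) :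
    ∫ x, fderiv ℝ g x v ∂μ = 0 := by
  have h := integral_smul_fderiv_eq_neg_fderiv_smul_of_integrable (μ := μ) (𝕜 := ℝ)
    (f := fun _ => 1) (g := g) (v := v) (by simp) (by simpa using hg'int)
    (by simpa using hgint) (fun _ _ => differentiableAt_const _) (fun x _ => hg x)
  simpa using h

/-- If `F : ℝ³ → ℝ³` is a `C¹` vector field which is Lebesgue integrable and whose
Fréchet derivative has Lebesgue integrable operator norm, then `∫ div F = 0`. -/
theorem integral_div_eq_zero
    (F : E3 → E3) (hF : ContDiff ℝ 1 F)
    (hFint : Integrable F)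
    (hDFint : Integrable fun x => ‖fderiv ℝ F x‖) :
    ∫ x, div3 F x = 0 := by
  have hcont : Continuous (fderiv ℝ F) := hF.continuous_fderiv one_ne_zero
  have hD : Integrable (fderiv ℝ F) :=
    (integrable_norm_iff hcont.aestronglyMeasurable).1 hDFint
  have hDv (v : E3) : Integrable fun x => fderiv ℝ F x v := hD.apply_continuousLinearMap v
  have hcoord (i : Fin 3) (v : E3) : Integrable fun x => fderiv ℝ F x v i :=
    (EuclideanSpace.proj (𝕜 := ℝ) i).integrable_comp (hDv v)
  unfold div3
  rw [integral_finsetSum _ fun i _ => hcoord i _]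
  refine Finset.sum_eq_zero fun i _ => ?_
  have h := (EuclideanSpace.proj (𝕜 := ℝ) i).integral_comp_comm
    (hDv (EuclideanSpace.single i 1))
  rw [integral_fderiv_apply_eq_zero (hF.differentiable one_ne_zero) hFint (hDv _),
    map_zero] at h
  exact h
end

section
/- Let T > 0 and κ ∈ ℝ. Let u : [0,T] × ℝ³ → ℝ³ be continuous with x ↦ u(t,x) C¹ for each t and with (t,x) ↦ div_x u(t,x) continuous, and let c : [0,T] × ℝ³ → ℝ be C¹ and satisfy ∂_t c + u·∇_x c + κ c div_x u = 0 on [0,T] × ℝ³. Assume that through every point (t,x) ∈ [0,T] × ℝ³ there is a characteristic curve, i.e. an X : [0,T] → ℝ³ with X(t) = x and X'(s) = u(s, X(s)) for all s ∈ [0,T]. Then: (a) if c(0,y) ≥ 0 for all y ∈ ℝ³, then c(t,x) ≥ 0 for all (t,x) ∈ [0,T] × ℝ³; (b) if moreover there are δ > 0 with c(0,y) ≥ δ for all y, and an integrable function D : [0,T] → ℝ with |div_x u(s,y)| ≤ D(s) for all s ∈ [0,T], y ∈ ℝ³, then c(t,x) ≥ δ · exp( −|κ| ∫₀ᵀ D(s)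 ds ) > 0 for all (t,x) ∈ [0,T] × ℝ³. -/
open MeasureTheory

open Set in
/-- The solution of a scalar linear equation `g' = b g` is `g 0` times an exponential. -/
theorem eq_mul_exp_integral_of_hasDerivAt {T : ℝ} (hT : 0 ≤ T) {g b : ℝ → ℝ}
    (hb : ContinuousOn b (Icc 0 T)) (hg : ∀ s ∈ Icc 0 T, HasDerivAt g (b s * g s) s)
    {t : ℝ} (ht : t ∈ Icc 0 T) : g t = g 0 * Real.exp (∫ s in (0 : ℝ)..t, b s) := by
  set B : ℝ → ℝ := IccExtend hT ((Icc 0 T).domRestrict b) with hB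
  have hBc : Continuous B := hb.domRestrict.Icc_extend'
  have hBb : ∀ s ∈ Icc 0 T, B s = b s := fun s hs => by
    rw [hB, IccExtend_of_mem hT _ hs]; rfl
  have hd : ∀ s ∈ Icc 0 T,
      HasDerivAt (fun s => g s * Real.exp (-∫ r in (0 : ℝ)..s, B r)) 0 s := by
    intro s hs
    have hI : HasDerivAt (fun s => ∫ r in (0 : ℝ)..s, B r) (B s) s :=
      intervalIntegral.integral_hasDerivAt_right (hBc.intervalIntegrable _ _)
        (hBc.stronglyMeasurableAtFilter _ _) hBc.continuousAt
    refine ((hg s hs).mul hI.neg.exp).congr_deriv ?_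
    rw [hBb s hs]
    ring
  have hconst := constant_of_has_deriv_right_zero
    (fun s hs => (hd s hs).continuousAt.continuousWithinAt)
    (fun s hs => (hd s (Ico_subset_Icc_self hs)).hasDerivWithinAt) t ht
  have hint : ∫ s in (0 : ℝ)..t, b s = ∫ s in (0 : ℝ)..t, B s := by
    refine intervalIntegral.integral_congr fun s hs => ?_
    rw [uIcc_of_le ht.1] at hs
    exact (hBb s ⟨hs.1, hs.2.trans ht.2⟩).symm
  simp only [intervalIntegral.integral_same, neg_zero, Real.exp_zero, mul_one] at hconst
  rw [hint, ← hconst, mul_assoc, ← Real.exp_add, neg_add_cancel, Real.exp_zero, mul_one]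

/-- Solutions of the transport equation `∂ₜ c + u·∇ₓ c + κ c divₓ u = 0` preserve
nonnegativity of the initial data; and if the initial data is bounded below by
`δ > 0` and `|divₓ u|` is dominated by an integrable function `D` on `[0,T]`, then
`c(t,x) ≥ δ · exp(−|κ| ∫₀ᵀ D) > 0` on `[0,T] × ℝ³`. Here `∂ₜ c + u·∇ₓ c` is
expressed as the full (space–time) derivative of `c` applied to `(1, u(t,x))`. -/
theorem transport_preserves_lower_bounds
    (T : ℝ) (hT : 0 < T) (κ : ℝ)
    (u : ℝ → E3 → E3) (c : ℝ → E3 → ℝ)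
    (hu_cont : Continuous fun p : ℝ × E3 => u p.1 p.2)
    (hu_C1 : ∀ t : ℝ, ContDiff ℝ 1 (u t))
    (hdivu_cont : Continuous fun p : ℝ × E3 => div3 (u p.1) p.2)
    (hc_C1 : ContDiff ℝ 1 fun p : ℝ × E3 => c p.1 p.2)
    (heq : ∀ t ∈ Set.Icc (0 : ℝ) T, ∀ x : E3,
      fderiv ℝ (fun p : ℝ × E3 => c p.1 p.2) (t, x) (1, u t x) +
        κ * c t x * div3 (u t) x = 0)
    (hchar : ∀ t ∈ Set.Icc (0 : ℝ) T, ∀ x : E3, ∃ X : ℝ → E3,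
      X t = x ∧ ∀ s ∈ Set.Icc (0 : ℝ) T, HasDerivAt X (u s (X s)) s) :
    ((∀ y : E3, 0 ≤ c 0 y) → ∀ t ∈ Set.Icc (0 : ℝ) T, ∀ x : E3, 0 ≤ c t x) ∧
    (∀ δ : ℝ, 0 < δ → (∀ y : E3, δ ≤ c 0 y) →
      ∀ D : ℝ → ℝ, IntegrableOn D (Set.Icc (0 : ℝ) T) →
        (∀ s ∈ Set.Icc (0 : ℝ) T, ∀ y : E3, |div3 (u s) y| ≤ D s) →
        ∀ t ∈ Set.Icc (0 : ℝ) T, ∀ x : E3,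
          δ * Real.exp (-|κ| * ∫ s in (0 : ℝ)..T, D s) ≤ c t x ∧
          0 < δ * Real.exp (-|κ| * ∫ s in (0 : ℝ)..T, D s)) := by
  have key : ∀ t ∈ Set.Icc (0 : ℝ) T, ∀ x : E3, ∃ X : ℝ → E3,
      ContinuousOn (fun s => div3 (u s) (X s)) (Set.Icc 0 T) ∧
      c t x = c 0 (X 0) * Real.exp (∫ s in (0 : ℝ)..t, -κ * div3 (u s) (X s)) := by
    intro t ht x
    obtain ⟨X, rfl, hX⟩ := hchar t ht x
    have hdiv : ContinuousOn (fun s => div3 (u s) (X s)) (Set.Icc 0 T) :=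
      hdivu_cont.comp_continuousOn
        (continuousOn_id.prodMk fun s hs => (hX s hs).continuousAt.continuousWithinAt)
    refine ⟨X, hdiv, eq_mul_exp_integral_of_hasDerivAt (g := fun s => c s (X s)) hT.le
      (continuousOn_const.mul hdiv) (fun s hs => ?_) ht⟩
    have hc := (hc_C1.differentiable one_ne_zero (s, X s)).hasFDerivAt
    refine (hc.comp_hasDerivAt s ((hasDerivAt_id s).prodMk (hX s hs))).congr_deriv ?_
    simp only [Pi.mul_apply]
    linear_combination heq s hs (X s)
  refine ⟨fun h0 t ht x => ?_, fun δ hδ h0 D hD hdom t ht x => ⟨?_, by positivity⟩⟩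
  · obtain ⟨X, -, hX⟩ := key t ht x
    rw [hX]
    exact mul_nonneg (h0 _) (Real.exp_pos _).le
  · obtain ⟨X, hdiv, hX⟩ := key t ht x
    rw [hX]
    have hsub : Set.Icc 0 t ⊆ Set.Icc 0 T := Set.Icc_subset_Icc_right ht.2
    have hDT : IntervalIntegrable D volume 0 T :=
      (intervalIntegrable_iff_integrableOn_Icc_of_le hT.le).2 hD
    have hDt : IntervalIntegrable D volume 0 t :=
      (intervalIntegrable_iff_integrableOn_Icc_of_le ht.1).2 (hD.mono_set hsub)
    have hmono : ∫ s in (0 : ℝ)..t, D s ≤ ∫ s in (0 : ℝ)..T, D s := by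
      refine intervalIntegral.integral_mono_interval le_rfl ht.1 ht.2 ?_ hDT
      filter_upwards [ae_restrict_mem measurableSet_Ioc] with s hs
      exact (abs_nonneg _).trans (hdom s (Set.Ioc_subset_Icc_self hs) 0)
    have hle : ∫ s in (0 : ℝ)..t, -|κ| * D s ≤
        ∫ s in (0 : ℝ)..t, -κ * div3 (u s) (X s) := by
      refine intervalIntegral.integral_mono_on ht.1 (hDt.const_mul _) ?_ fun s hs => ?_
      · exact ((continuousOn_const.mul hdiv).mono
          (by rwa [Set.uIcc_of_le ht.1])).intervalIntegrable
      · have h1 := mul_le_mul_of_nonneg_left (hdom s (hsub hs) (X s)) (abs_nonneg κ)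
        rw [← abs_mul] at h1
        linarith [le_abs_self (κ * div3 (u s) (X s))]
    rw [intervalIntegral.integral_const_mul] at hle
    refine mul_le_mul (h0 _) (Real.exp_le_exp.2 (le_trans ?_ hle)) (Real.exp_pos _).le
      (hδ.le.trans (h0 _))
    exact mul_le_mul_of_nonpos_left hmono (neg_nonpos.2 (abs_nonneg κ))
end
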